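/- Let k ∈ ℕ, let G be a locally finite graph, and let ω be an end of G. Then the edge-degree of ω equals k if and only if k is the smallest integer such that every finite set S ⊆ V(G) can be separated from ω by an edge-cut of size k. -/

import Mathlib

open SimpleGraph Cardinal

universe u v

variable {V : Type u}

/-- A ray in `G`: an injective sequence of vertices with consecutive vertices adjacent. -/
def IsRay (G : SimpleGraph V) (f : ℕ → V) : Prop :=
  Function.Injective f ∧ ∀ n : ℕ, G.Adj (f n) (f (n + 1))

/-- Two rays are equivalent (belong to the same end) if no finite vertex set separates them:
for every finite `S` there are arbitrarily late vertices of the two rays joined by a walk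
avoiding `S`. -/
def RayEquiv (G : SimpleGraph V) (f g : ℕ → V) : Prop :=
  ∀ S : Finset V, ∀ m₀ n₀ : ℕ, ∃ m n : ℕ, m₀ ≤ m ∧ n₀ ≤ n ∧
    ∃ w : G.Walk (f m) (g n), ∀ x ∈ w.support, x ∉ S

/-- `G` has `H` as a minor: disjoint nonempty connected branch sets, one for each vertex of
`H`, with edges of `G` between branch sets corresponding to adjacent vertices of `H`. -/
def HasMinor {W : Type v} (G : SimpleGraph V) (H : SimpleGraph W) : Prop :=
  ∃ B : W → Set V, (∀ w, (B w).Nonempty) ∧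
    (Pairwise fun w w' => Disjoint (B w) (B w')) ∧
    (∀ w, (G.induce (B w)).Connected) ∧
    ∀ ⦃w w'⦄, H.Adj w w' → ∃ u ∈ B w, ∃ x ∈ B w', G.Adj u x

/-- The `[k] × ℕ` grid. -/
def gridN (k : ℕ) : SimpleGraph (Fin k × ℕ) :=
  SimpleGraph.fromRel fun a b =>
    (a.1 = b.1 ∧ b.2 = a.2 + 1) ∨ (a.2 = b.2 ∧ (b.1 : ℕ) = (a.1 : ℕ) + 1)

/-- The `ℕ × ℕ` grid. -/
def gridNN : SimpleGraph (ℕ × ℕ) :=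
  SimpleGraph.fromRel fun a b =>
    (a.1 = b.1 ∧ b.2 = a.2 + 1) ∨ (a.2 = b.2 ∧ b.1 = a.1 + 1)

/-- `G` is `k`-connected: more than `k` vertices, and deleting fewer than `k` vertices
leaves a connected graph. -/
def KConnected (G : SimpleGraph V) (k : ℕ) : Prop :=
  (k : Cardinal) < #V ∧
  ∀ S : Finset V, S.card < k → (G.induce ((S : Set V))ᶜ).Connected

/-- `G` is `k`-edge-connected: deleting fewer than `k` edges leaves a connected graph. -/
def KEdgeConnected (G : SimpleGraph V) (k : ℕ) : Prop :=
  ∀ F : Finset (Sym2 V), F.card < k → (G.deleteEdges (F : Set (Sym2 V))).Connected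

/-- There are `m` pairwise vertex-disjoint rays all in the end of the ray `f`. -/
def HasVDisjointRays (G : SimpleGraph V) (f : ℕ → V) (m : ℕ) : Prop :=
  ∃ F : Fin m → ℕ → V, (∀ i, IsRay G (F i)) ∧ (∀ i, RayEquiv G (F i) f) ∧
    Pairwise fun i j => Disjoint (Set.range (F i)) (Set.range (F j))

/-- The set of edges used by a ray. -/
def rayEdges (f : ℕ → V) : Set (Sym2 V) := Set.range fun n => s(f n, f (n + 1))

/-- There are `m` pairwise edge-disjoint rays all in the end of the ray `f`. -/
def HasEDisjointRays (G : SimpleGraph V) (f : ℕ → V) (m : ℕ) : Prop :=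
  ∃ F : Fin m → ℕ → V, (∀ i, IsRay G (F i)) ∧ (∀ i, RayEquiv G (F i) f) ∧
    Pairwise fun i j => Disjoint (rayEdges (F i)) (rayEdges (F j))

/-- `G` is `k`-connected but deleting any edge destroys `k`-connectivity. -/
def EdgeMinKConnected (G : SimpleGraph V) (k : ℕ) : Prop :=
  KConnected G k ∧ ∀ e ∈ G.edgeSet, ¬ KConnected (G.deleteEdges {e}) k

/-- `G` is `k`-connected but deleting any vertex destroys `k`-connectivity. -/
def VertexMinKConnected (G : SimpleGraph V) (k : ℕ) : Prop :=
  KConnected G k ∧ ∀ x : V, ¬ KConnected (G.induce {x}ᶜ) k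

/-- The edge set `F` separates the finite set `S` from the end of the ray `f`: no walk
avoiding the edges of `F` joins a tail of `f` to `S`. -/
def EdgeCutSeparates {V : Type u} (G : SimpleGraph V) (F : Finset (Sym2 V))
    (S : Finset V) (f : ℕ → V) : Prop :=
  ∃ N : ℕ, ∀ n, N ≤ n → ∀ s ∈ S, ¬ ∃ w : G.Walk (f n) s, ∀ e ∈ w.edges, e ∉ F

/-- Hitting sets of bounded size are detected by finite subfamilies. -/
theorem exists_finite_subfamily_not_hit {α : Type*} (k : ℕ) :
    ∀ P : Set (Finset α), (∀ T : Finset α, T.card < k → ∃ p ∈ P, Disjoint p T) →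
      ∃ Q : Set (Finset α), Q ⊆ P ∧ Q.Finite ∧
        ∀ T : Finset α, T.card < k → ∃ p ∈ Q, Disjoint p T := by
  classical
  induction k with
  | zero => exact fun P _ => ⟨∅, by simp, by simp, by simp⟩
  | succ k ih =>
    intro P hP
    obtain ⟨p₀, hp₀, -⟩ := hP ∅ (by simp)
    have key : ∀ x : α, ∃ Q : Set (Finset α), Q ⊆ {p ∈ P | x ∉ p} ∧ Q.Finite ∧
        ∀ T : Finset α, T.card < k → ∃ p ∈ Q, Disjoint p T := by
      intro x
      apply ih
      intro T hT
      obtain ⟨p, hp, hd⟩ := hP (insert x T) ((Finset.card_insert_le _ _).trans_lt (by omega))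
      rw [Finset.disjoint_insert_right] at hd
      exact ⟨p, ⟨hp, hd.1⟩, hd.2⟩
    choose Q hQP hQf hQ using key
    refine ⟨insert p₀ (⋃ x ∈ p₀, Q x), ?_, ?_, ?_⟩
    · rintro p (rfl | hp)
      · exact hp₀
      · simp only [Set.mem_iUnion] at hp
        obtain ⟨x, -, hx⟩ := hp
        exact (hQP x hx).1
    · exact (p₀.finite_toSet.biUnion fun x _ => hQf x).insert _
    · intro T hT
      by_cases hd : Disjoint p₀ T
      · exact ⟨p₀, Set.mem_insert _ _, hd⟩
      · obtain ⟨x, hx, hxT⟩ := Finset.not_disjoint_iff.1 hd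
        obtain ⟨p, hp, hpd⟩ := hQ x (T.erase x) (by
          rw [Finset.card_erase_of_mem hxT]
          have := Finset.card_pos.2 ⟨x, hxT⟩
          omega)
        refine ⟨p, Or.inr (Set.mem_biUnion hx hp), ?_⟩
        rw [Finset.disjoint_left] at hpd ⊢
        intro y hy hyT
        refine hpd hy (Finset.mem_erase.2 ⟨?_, hyT⟩)
        rintro rfl
        exact (hQP _ hp).2 hy

theorem IsRay.edge_injective {G : SimpleGraph V} {f : ℕ → V} (hf : IsRay G f) :
    Function.Injective fun n => s(f n, f (n + 1)) := by
  intro m n h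
  simp only [Sym2.eq_iff] at h
  rcases h with ⟨h, -⟩ | ⟨h₁, h₂⟩
  · exact hf.1 h
  · have := hf.1 h₁
    have := hf.1 h₂
    omega

theorem IsRay.exists_forall_ge_notMem {G : SimpleGraph V} {f : ℕ → V} (hf : IsRay G f)
    (S : Finset V) : ∃ N, ∀ n, N ≤ n → f n ∉ S := by
  obtain ⟨N, hN⟩ := (S.finite_toSet.preimage hf.1.injOn).bddAbove
  refine ⟨N + 1, fun n hn h => ?_⟩
  have := hN h
  omega

theorem IsRay.exists_forall_ge_edge_notMem {G : SimpleGraph V} {f : ℕ → V} (hf : IsRay G f)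
    (T : Finset (Sym2 V)) : ∃ N, ∀ n, N ≤ n → s(f n, f (n + 1)) ∉ T := by
  obtain ⟨N, hN⟩ := (T.finite_toSet.preimage hf.edge_injective.injOn).bddAbove
  refine ⟨N + 1, fun n hn h => ?_⟩
  have := hN h
  omega

/-- A walk from a vertex of `C` to a vertex outside `C` uses an edge of the boundary of `C`. -/
theorem exists_boundary_edge {G : SimpleGraph V} (C : Set V) {x y : V} (w : G.Walk x y)
    (hx : x ∈ C) (hy : y ∉ C) :
    ∃ e ∈ w.edges, e ∈ G.edgeSet ∧ (∃ v ∈ e, v ∈ C) ∧ ∃ v ∈ e, v ∉ C := by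
  obtain ⟨d, hd, h₁, h₂⟩ := w.exists_boundary_dart C hx hy
  exact ⟨d.edge, List.mem_map_of_mem hd, d.edge_mem,
    ⟨d.fst, by simp [SimpleGraph.Dart.edge], h₁⟩,
    ⟨d.snd, by simp [SimpleGraph.Dart.edge], h₂⟩⟩

theorem finite_incidenceSet_of_finite_neighborSet {G : SimpleGraph V} {x : V}
    (h : (G.neighborSet x).Finite) : (G.incidenceSet x).Finite := by
  refine (h.image fun y => s(x, y)).subset ?_
  rintro e ⟨he, hx⟩
  obtain ⟨y, rfl⟩ := Sym2.mem_iff_exists.1 hx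
  exact ⟨y, he, rfl⟩

/-- `C` is a connected vertex set containing a tail of `f` and missing `S`, with edge boundary
`F` of minimum size among the edge sets separating `S` from the end of `f`. -/
structure IsMinEndCut (G : SimpleGraph V) (f : ℕ → V) (S : Finset V) (C : Set V)
    (F : Finset (Sym2 V)) : Prop where
  notMem : ∀ s ∈ S, s ∉ C
  tail : ∃ N, ∀ n, N ≤ n → f n ∈ C
  conn : ∀ x ∈ C, ∀ y ∈ C, ∃ w : G.Walk x y, ∀ z ∈ w.support, z ∈ C
  mem_iff : ∀ e, e ∈ F ↔ e ∈ G.edgeSet ∧ (∃ v ∈ e, v ∈ C) ∧ ∃ v ∈ e, v ∉ C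
  min : ∀ T, EdgeCutSeparates G T S f → F.card ≤ T.card

theorem IsMinEndCut.separates {G : SimpleGraph V} {f : ℕ → V} {S : Finset V} {C : Set V}
    {F : Finset (Sym2 V)} (h : IsMinEndCut G f S C F) : EdgeCutSeparates G F S f := by
  obtain ⟨N, hN⟩ := h.tail
  refine ⟨N, fun n hn s hs ⟨w, hw⟩ => ?_⟩
  obtain ⟨e, he, h'⟩ := exists_boundary_edge C w (hN n hn) (h.notMem s hs)
  exact hw e he ((h.mem_iff e).2 h')

theorem exists_edgeCutSeparates {G : SimpleGraph V} (hlf : ∀ x : V, (G.neighborSet x).Finite)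
    {f : ℕ → V} (hf : IsRay G f) (S : Finset V) :
    ∃ T : Finset (Sym2 V), EdgeCutSeparates G T S f := by
  have hfin : (⋃ x ∈ S, G.incidenceSet x).Finite :=
    S.finite_toSet.biUnion fun x _ => finite_incidenceSet_of_finite_neighborSet (hlf x)
  obtain ⟨N, hN⟩ := hf.exists_forall_ge_notMem S
  refine ⟨hfin.toFinset, N, fun n hn s hs ⟨w, hw⟩ => ?_⟩
  obtain ⟨e, he, hE, -, v, hv, hvS⟩ := exists_boundary_edge ((S : Set V)ᶜ) w
    (by simpa using hN n hn) (by simpa using hs)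
  refine hw e he ?_
  simp only [Set.Finite.mem_toFinset, Set.mem_iUnion]
  exact ⟨v, by simpa using hvS, hE, hv⟩

theorem exists_isMinEndCut {G : SimpleGraph V} (hlf : ∀ x : V, (G.neighborSet x).Finite)
    {f : ℕ → V} (hf : IsRay G f) (S : Finset V) :
    ∃ C F, IsMinEndCut G f S C F := by
  classical
  obtain ⟨T, hT, hmin⟩ := WellFounded.has_min (measure (Finset.card (α := Sym2 V))).wf
    {T | EdgeCutSeparates G T S f} (exists_edgeCutSeparates hlf hf S)
  obtain ⟨N, hN⟩ := hT
  obtain ⟨N', hN'⟩ := hf.exists_forall_ge_edge_notMem T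
  set M := max N N' with hM
  set C : Set V := {v | ∃ w : G.Walk (f M) v, ∀ e ∈ w.edges, e ∉ T} with hC
  have hstep : ∀ u v, u ∈ C → G.Adj u v → s(u, v) ∉ T → v ∈ C := by
    rintro u v ⟨w, hw⟩ huv hT
    refine ⟨w.concat huv, fun e he => ?_⟩
    rw [Walk.edges_concat, List.concat_eq_append, List.mem_append, List.mem_singleton] at he
    rcases he with he | rfl
    exacts [hw e he, hT]
  have hconn : ∀ x ∈ C, ∃ w : G.Walk (f M) x, ∀ z ∈ w.support, z ∈ C := by
    rintro x ⟨w, hw⟩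
    exact ⟨w, fun z hz => ⟨w.takeUntil z hz,
      fun e he => hw e (w.edges_takeUntil_subset_edges hz he)⟩⟩
  refine ⟨C, T.filter fun e => e ∈ G.edgeSet ∧ (∃ v ∈ e, v ∈ C) ∧ ∃ v ∈ e, v ∉ C,
    ?_, ?_, ?_, ?_, ?_⟩
  · rintro s hs ⟨w, hw⟩
    exact hN M (le_max_left _ _) s hs ⟨w, hw⟩
  · refine ⟨M, fun n hn => ?_⟩
    induction n, hn using Nat.le_induction with
    | base => exact ⟨Walk.nil, by simp⟩
    | succ n hn ih => exact hstep _ _ ih (hf.2 n) (hN' n ((le_max_right _ _).trans hn))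
  · intro x hx y hy
    obtain ⟨w₁, h₁⟩ := hconn x hx
    obtain ⟨w₂, h₂⟩ := hconn y hy
    refine ⟨w₁.reverse.append w₂, fun z hz => ?_⟩
    rw [Walk.mem_support_append_iff, Walk.support_reverse, List.mem_reverse] at hz
    exact hz.elim (h₁ z) (h₂ z)
  · intro e
    rw [Finset.mem_filter]
    refine ⟨fun h => h.2, fun h => ⟨?_, h⟩⟩
    obtain ⟨hE, ⟨u, hu, huC⟩, v, hv, hvC⟩ := h
    have huv : u ≠ v := by
      rintro rfl
      exact hvC huC
    obtain rfl := (Sym2.mem_and_mem_iff huv).1 ⟨hu, hv⟩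
    by_contra hT
    exact hvC (hstep u v huC hE hT)
  · intro T' hT'
    refine (Finset.card_filter_le _ _).trans ?_
    have := hmin T' hT'
    exact not_lt.1 this

/-- Two edges share an endvertex. -/
def EdgesTouch (e e' : Sym2 V) : Prop := ∃ v, v ∈ e ∧ v ∈ e'

/-- The Hall-type step: between two nested minimum cuts there is a finite zone of edges on which
edges outside the far cut can be shifted injectively, to touching edges, off the near cut. -/
theorem IsMinEndCut.exists_shift {G : SimpleGraph V} {f : ℕ → V} {S S' : Finset V} {C C' : Set V}
    {F F' : Finset (Sym2 V)} (h : IsMinEndCut G f S C F) (h' : IsMinEndCut G f S' C' F')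
    (hCC : C' ⊆ C) :
    ∃ (H : Finset (Sym2 V)) (σ : Sym2 V → Sym2 V), F ⊆ H ∧
      (∀ e ∈ H, e ∈ G.edgeSet ∧ (∃ v ∈ e, v ∈ C) ∧ ∃ v ∈ e, v ∉ C') ∧
      (∀ e ∈ H, e ∉ F' → σ e ∈ H ∧ σ e ∉ F ∧ EdgesTouch e (σ e)) ∧
      Set.InjOn σ {e | e ∈ H ∧ e ∉ F'} := by
  classical
  obtain ⟨Q, hQP, hQf, hQ⟩ := exists_finite_subfamily_not_hit F.card
    {p : Finset (Sym2 V) | ∃ x ∈ C', ∃ s ∈ S, ∃ w : G.Walk s x, p = w.edges.toFinset} (by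
      intro T hT
      have hns : ¬ EdgeCutSeparates G T S f := fun hs => hT.not_ge (h.min T hs)
      obtain ⟨N, hN⟩ := h'.tail
      unfold EdgeCutSeparates at hns
      push Not at hns
      obtain ⟨n, hn, s, hs, w, hw⟩ := hns N
      refine ⟨_, ⟨f n, hN n hn, s, hs, w.reverse, rfl⟩, ?_⟩
      rw [Finset.disjoint_left]
      intro e he
      exact hw e (by simpa using he))
  set H : Finset (Sym2 V) := F ∪ (hQf.toFinset.biUnion id).filter
    (fun e => e ∈ G.edgeSet ∧ (∃ v ∈ e, v ∈ C) ∧ ∃ v ∈ e, v ∉ C') with hH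
  have hFH : F ⊆ H := Finset.subset_union_left
  have hHZ : ∀ e ∈ H, e ∈ G.edgeSet ∧ (∃ v ∈ e, v ∈ C) ∧ ∃ v ∈ e, v ∉ C' := by
    intro e he
    rcases Finset.mem_union.1 he with he | he
    · obtain ⟨h₁, h₂, v, hv, hvC⟩ := (h.mem_iff e).1 he
      exact ⟨h₁, h₂, v, hv, fun hv' => hvC (hCC hv')⟩
    · exact (Finset.mem_filter.1 he).2
  have hHQ : ∀ p ∈ Q, ∀ e ∈ p, e ∈ G.edgeSet → (∃ v ∈ e, v ∈ C) → (∃ v ∈ e, v ∉ C') →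
      e ∈ H := by
    intro p hp e he h₁ h₂ h₃
    refine Finset.mem_union_right _ (Finset.mem_filter.2 ⟨?_, h₁, h₂, h₃⟩)
    exact Finset.mem_biUnion.2 ⟨p, hQf.mem_toFinset.2 hp, he⟩
  let t : {e // e ∈ H ∧ e ∉ F'} → Finset (Sym2 V) := fun e =>
    H.filter fun e' => e' ∉ F ∧ EdgesTouch e.1 e'
  have hall : ∀ s : Finset {e // e ∈ H ∧ e ∉ F'}, s.card ≤ (s.biUnion t).card := by
    intro s
    set U : Finset (Sym2 V) := s.image Subtype.val with hU
    have hUmem : ∀ e ∈ U, e ∈ H ∧ e ∉ F' := by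
      intro e he
      obtain ⟨x, -, rfl⟩ := Finset.mem_image.1 he
      exact x.2
    have hUcard : U.card = s.card := Finset.card_image_of_injective _ Subtype.val_injective
    have hN : ∀ e ∈ U, ∀ e' ∈ H, EdgesTouch e e' → e' ∈ s.biUnion t ∪ F := by
      intro e he e' he' ht
      by_cases hF : e' ∈ F
      · exact Finset.mem_union_right _ hF
      · obtain ⟨x, hx, rfl⟩ := Finset.mem_image.1 he
        exact Finset.mem_union_left _
          (Finset.mem_biUnion.2 ⟨x, hx, Finset.mem_filter.2 ⟨he', hF, ht⟩⟩)
    have hUsub : U ⊆ s.biUnion t ∪ F := fun e he =>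
      hN e he e (hUmem e he).1 ⟨_, e.out_fst_mem, e.out_fst_mem⟩
    have hUC' : ∀ e ∈ U, ∀ v ∈ e, v ∉ C' := by
      intro e he v hv hvC'
      obtain ⟨h₁, -, h₃⟩ := hHZ e (hUmem e he).1
      exact (hUmem e he).2 ((h'.mem_iff e).2 ⟨h₁, ⟨v, hv, hvC'⟩, h₃⟩)
    have hT : F.card ≤ ((s.biUnion t ∪ F) \ U).card := by
      by_contra! hlt
      obtain ⟨p, hp, hpd⟩ := hQ _ hlt
      obtain ⟨x, hx, a, ha, w, hw⟩ := hQP hp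
      have hmem : ∀ e ∈ p, e ∈ s.biUnion t ∪ F → e ∈ U := by
        intro e he heN
        by_contra heU
        exact Finset.disjoint_left.1 hpd he (Finset.mem_sdiff.2 ⟨heN, heU⟩)
      have hwalk : ∀ {y z : V} (w : G.Walk y z), (∀ e ∈ w.edges, e ∈ p) →
          (y ∉ C' ∧ (y ∈ C → ∃ e ∈ U, y ∈ e)) → z ∉ C' := by
        intro y z w
        induction w with
        | nil => exact fun _ h => h.1
        | @cons u v z huv w ih =>
          intro hwp ⟨huC', huC⟩
          refine ih (fun e he => hwp e (List.mem_cons_of_mem _ he)) ?_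
          have he : s(u, v) ∈ p := hwp _ (by simp)
          by_cases hv : v ∈ C
          · suffices hs : s(u, v) ∈ U from
              ⟨hUC' _ hs v (Sym2.mem_mk_right u v), fun _ => ⟨_, hs, Sym2.mem_mk_right u v⟩⟩
            apply hmem _ he
            by_cases hu : u ∈ C
            · obtain ⟨e', he', hue'⟩ := huC hu
              exact hN e' he' _ (hHQ p hp _ he huv ⟨v, Sym2.mem_mk_right u v, hv⟩
                ⟨u, Sym2.mem_mk_left u v, huC'⟩) ⟨u, hue', Sym2.mem_mk_left u v⟩
            · exact Finset.mem_union_right _ ((h.mem_iff _).2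
                ⟨huv, ⟨v, Sym2.mem_mk_right u v, hv⟩, u, Sym2.mem_mk_left u v, hu⟩)
          · exact ⟨fun hv' => hv (hCC hv'), fun hv' => absurd hv' hv⟩
      have haC := h.notMem a ha
      exact hwalk w (fun e he => by rw [hw]; simpa using he)
        ⟨fun h => haC (hCC h), fun h => absurd h haC⟩ hx
    have h₁ := Finset.card_sdiff_add_card_eq_card hUsub
    have h₂ := Finset.card_union_le (s.biUnion t) F
    omega
  obtain ⟨σ, hσ, hσt⟩ := (Finset.all_card_le_biUnion_card_iff_exists_injective t).1 hall
  refine ⟨H, fun e => if he : e ∈ H ∧ e ∉ F' then σ ⟨e, he⟩ else e, hFH, hHZ, ?_, ?_⟩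
  · intro e he he'
    have := hσt ⟨e, he, he'⟩
    simp only [t, Finset.mem_filter] at this
    simpa [he, he'] using this
  · intro e he e' he' heq
    simp only [Set.mem_ofPred_eq] at he he'
    simp only [dif_pos he, dif_pos he'] at heq
    exact congrArg Subtype.val (hσ heq)

/-- An injective sequence of successively touching edges contains a ray. -/
theorem exists_ray_of_edge_sequence {G : SimpleGraph V}
    (hlf : ∀ x : V, (G.neighborSet x).Finite) (e : ℕ → Sym2 V) (he : Function.Injective e)
    (heG : ∀ n, e n ∈ G.edgeSet) (ht : ∀ n, EdgesTouch (e n) (e (n + 1))) :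
    ∃ (v : ℕ → V) (j : ℕ → ℕ), IsRay G v ∧ ∀ i, s(v i, v (i + 1)) = e (j i) := by
  classical
  have hlast : ∀ x : {x : V // ∃ n, x ∈ e n}, ∃ n, x.1 ∈ e n ∧ ∀ m, x.1 ∈ e m → m ≤ n := by
    rintro ⟨x, hx⟩
    have hfin : {n | x ∈ e n}.Finite := by
      refine ((finite_incidenceSet_of_finite_neighborSet (hlf x)).preimage he.injOn).subset ?_
      exact fun n hn => ⟨heG n, hn⟩
    obtain ⟨n, hn⟩ := hfin.exists_maximal hx
    exact ⟨n, hn.1, fun m hm => (le_total m n).elim id fun h => hn.2 hm h⟩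
  choose l hl hlmax using hlast
  have hnext : ∀ x : {x : V // ∃ n, x ∈ e n}, ∃ y : {x : V // ∃ n, x ∈ e n},
      s(x.1, y.1) = e (l x) ∧ l x < l y := by
    intro x
    obtain ⟨y, hy⟩ := Sym2.mem_iff_exists.1 (hl x)
    have hyn : y ∈ e (l x + 1) := by
      obtain ⟨z, hz, hz'⟩ := ht (l x)
      rw [hy, Sym2.mem_iff] at hz
      rcases hz with rfl | rfl
      · have := hlmax x _ hz'
        omega
      · exact hz'
    exact ⟨⟨y, _, hyn⟩, hy.symm, hlmax ⟨y, _, hyn⟩ _ hyn⟩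
  choose nxt hnxt hlt using hnext
  let v : ℕ → {x : V // ∃ n, x ∈ e n} := fun i => nxt^[i] ⟨_, 0, (e 0).out_fst_mem⟩
  have hv : ∀ i, v (i + 1) = nxt (v i) := fun i => Function.iterate_succ_apply' _ _ _
  have hmono : StrictMono fun i => l (v i) :=
    strictMono_nat_of_lt_succ fun i => by rw [hv]; exact hlt _
  have hedge : ∀ i, s((v i).1, (v (i + 1)).1) = e (l (v i)) := fun i => by
    rw [hv]; exact hnxt _
  refine ⟨fun i => (v i).1, fun i => l (v i), ⟨?_, ?_⟩, hedge⟩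
  · intro a b hab
    exact hmono.injective (congrArg l (Subtype.ext hab))
  · intro n
    rw [← SimpleGraph.mem_edgeSet, hedge]
    exact heG _

theorem iterate_injective_of_notMem_range {α : Type*} {σ : α → α} (hσ : Function.Injective σ)
    {a b : α} (ha : a ∉ Set.range σ) (hb : b ∉ Set.range σ) {i j : ℕ}
    (h : σ^[i] a = σ^[j] b) : i = j ∧ a = b := by
  induction i generalizing j with
  | zero =>
    cases j with
    | zero => exact ⟨rfl, h⟩
    | succ j =>
      rw [Function.iterate_succ_apply'] at h
      exact absurd ⟨_, h.symm⟩ ha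
  | succ i ih =>
    cases j with
    | zero =>
      rw [Function.iterate_succ_apply'] at h
      exact absurd ⟨_, h⟩ hb
    | succ j =>
      rw [Function.iterate_succ_apply', Function.iterate_succ_apply'] at h
      obtain ⟨hij, hab⟩ := ih (hσ h)
      exact ⟨congrArg _ hij, hab⟩

theorem exists_finset_neighbors_endpoints {G : SimpleGraph V} (hlf : ∀ x : V, (G.neighborSet x).Finite)
    (S : Finset V) (F : Finset (Sym2 V)) :
    ∃ S' : Finset V, (∀ x ∈ S, ∀ y, G.Adj x y → y ∈ S') ∧ ∀ e ∈ F, ∀ v ∈ e, v ∈ S' := by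
  classical
  refine ⟨S.biUnion (fun x => (hlf x).toFinset) ∪ F.biUnion Sym2.toFinset,
    fun x hx y hxy => ?_, fun e he v hv => ?_⟩
  · exact Finset.mem_union_left _ (Finset.mem_biUnion.2 ⟨x, hx, by simpa using hxy⟩)
  · exact Finset.mem_union_right _ (Finset.mem_biUnion.2 ⟨e, he, Sym2.mem_toFinset.2 hv⟩)

theorem IsMinEndCut.subset {G : SimpleGraph V} {f : ℕ → V} {S S' : Finset V} {C C' : Set V}
    {F F' : Finset (Sym2 V)} (h : IsMinEndCut G f S C F) (h' : IsMinEndCut G f S' C' F')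
    (hF : ∀ e ∈ F, ∀ v ∈ e, v ∈ S') : C' ⊆ C := by
  intro x hx
  by_contra hxC
  obtain ⟨N, hN⟩ := h.tail
  obtain ⟨N', hN'⟩ := h'.tail
  obtain ⟨w, hw⟩ := h'.conn _ (hN' (max N N') (le_max_right _ _)) x hx
  obtain ⟨e, he, hb⟩ := exists_boundary_edge C w (hN _ (le_max_left _ _)) hxC
  obtain ⟨v, hv, -⟩ := hb.2.1
  exact h'.notMem v (hF e ((h.mem_iff e).2 hb) v hv) (hw v (Walk.mem_support_of_mem_edges he hv))

/-- An infinite nested sequence of minimum cuts converging to the end of `f`. -/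
theorem exists_isMinEndCut_sequence {G : SimpleGraph V}
    (hlf : ∀ x : V, (G.neighborSet x).Finite) {f : ℕ → V} (hf : IsRay G f) (S₀ : Finset V) :
    ∃ (S : ℕ → Finset V) (C : ℕ → Set V) (F : ℕ → Finset (Sym2 V)), S 0 = S₀ ∧
      (∀ n, IsMinEndCut G f (S n) (C n) (F n)) ∧
      (∀ n, ∀ x ∈ S n, ∀ y, G.Adj x y → y ∈ S (n + 1)) ∧
      ∀ n, ∀ e ∈ F n, ∀ v ∈ e, v ∈ S (n + 1) := by
  choose C F hCF using exists_isMinEndCut hlf hf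
  choose g hg₁ hg₂ using exists_finset_neighbors_endpoints hlf
  let S : ℕ → Finset V := fun n => Nat.rec S₀ (fun _ T => g T (F T)) n
  exact ⟨S, fun n => C (S n), fun n => F (S n), rfl, fun n => hCF _,
    fun n => hg₁ _ _, fun n => hg₂ _ _⟩

/-- A ray with all but finitely many of its edges inside each of the sets `C n` belongs to the
end to which the sets `C n` converge. -/
theorem rayEquiv_of_edges_eventually_inside {G : SimpleGraph V} {f v : ℕ → V} {C : ℕ → Set V}
    (hv : IsRay G v) (hC : Antitone C) (htail : ∀ n, ∃ N, ∀ m, N ≤ m → f m ∈ C n)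
    (hconn : ∀ n, ∀ x ∈ C n, ∀ y ∈ C n, ∃ w : G.Walk x y, ∀ z ∈ w.support, z ∈ C n)
    (hexh : ∀ x, ∃ n, x ∉ C n) (hfin : ∀ n, {e ∈ rayEdges v | ∃ x ∈ e, x ∉ C n}.Finite) :
    RayEquiv G v f := by
  intro S m₀ n₀
  choose c hc using hexh
  obtain ⟨N, hN⟩ := htail (S.sup c)
  obtain ⟨M, hM⟩ := hv.exists_forall_ge_edge_notMem (hfin (S.sup c)).toFinset
  have hmem : v (max M m₀) ∈ C (S.sup c) := by
    by_contra h
    refine hM _ (le_max_left M m₀) ?_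
    rw [Set.Finite.mem_toFinset]
    exact ⟨⟨_, rfl⟩, _, Sym2.mem_mk_left _ _, h⟩
  obtain ⟨w, hw⟩ := hconn _ _ hmem _ (hN (max N n₀) (le_max_left _ _))
  exact ⟨_, _, le_max_right _ _, le_max_right _ _, w,
    fun x hx hxS => hc x (hC (Finset.le_sup hxS) (hw x hx))⟩

theorem hasEDisjointRays_of_forall_le_card {G : SimpleGraph V}
    (hlf : ∀ x : V, (G.neighborSet x).Finite) {f : ℕ → V} (hf : IsRay G f) {S₀ : Finset V}
    (h0 : f 0 ∈ S₀) {r : ℕ} (hr : ∀ C F, IsMinEndCut G f S₀ C F → r ≤ F.card) :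
    HasEDisjointRays G f r := by
  obtain ⟨S, C, F, hS0, hcut, hnbr, hFS⟩ := exists_isMinEndCut_sequence hlf hf S₀
  have hC : Antitone C := antitone_nat_of_succ_le fun n => (hcut n).subset (hcut (n + 1)) (hFS n)
  choose H σ hFH hHZ hσ hσinj using fun n =>
    (hcut n).exists_shift (hcut (n + 1)) (hC (Nat.le_succ n))
  have hexh : ∀ x, ∃ n, x ∉ C n := by
    intro x
    by_contra! hx
    obtain ⟨N, hN⟩ := (hcut 0).tail
    obtain ⟨w, -⟩ := (hcut 0).conn _ (hN N le_rfl) x (hx 0)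
    have hmem : ∀ {y z : V} (w : G.Walk y z), (∃ n, y ∈ S n) → ∃ n, z ∈ S n := by
      intro y z w
      induction w with
      | nil => exact id
      | cons h w ih => exact fun ⟨n, hn⟩ => ih ⟨n + 1, hnbr n _ hn _ h⟩
    have hfS : ∀ n, f n ∈ S n := by
      intro n
      induction n with
      | zero => rwa [hS0]
      | succ n ih => exact hnbr n _ ih _ (hf.2 n)
    obtain ⟨n, hn⟩ := hmem w ⟨N, hfS N⟩
    exact (hcut n).notMem x hn (hx n)
  have hlev : ∀ e : {e // ∃ n, e ∈ H n}, ∃ n, e.1 ∈ H n ∧ e.1 ∉ F (n + 1) := by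
    rintro ⟨e, n, hn⟩
    by_cases he : e ∈ F (n + 1)
    · refine ⟨n + 1, hFH _ he, fun he' => ?_⟩
      obtain ⟨-, ⟨v, hv, hvC⟩, -⟩ := ((hcut (n + 2)).mem_iff e).1 he'
      exact (hcut (n + 2)).notMem v (hFS (n + 1) e he v hv) hvC
    · exact ⟨n, hn, he⟩
  choose l hl hlF using hlev
  let τ : {e // ∃ n, e ∈ H n} → {e // ∃ n, e ∈ H n} := fun e =>
    ⟨σ (l e) e.1, l e, (hσ _ _ (hl e) (hlF e)).1⟩
  have hinside : ∀ n, ∀ e ∈ H n, e ∉ F n → ∀ v ∈ e, v ∈ C n := by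
    intro n e he heF v hv
    by_contra hvC
    exact heF (((hcut n).mem_iff e).2 ⟨(hHZ n e he).1, (hHZ n e he).2.1, v, hv, hvC⟩)
  have hlevel_le : ∀ {e m n}, e ∈ H m → e ∈ H n → e ∉ F n → n ≤ m := by
    intro e m n hm hn hF
    by_contra! hlt
    obtain ⟨-, -, v, hv, hvC⟩ := hHZ m e hm
    exact hvC (hC hlt (hinside n e hn hF v hv))
  have hτ : Function.Injective τ := by
    intro e e' heq
    have heq : σ (l e) e.1 = σ (l e') e'.1 := congrArg Subtype.val heq
    obtain ⟨h₁, h₂, -⟩ := hσ _ _ (hl e) (hlF e)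
    obtain ⟨h₁', h₂', -⟩ := hσ _ _ (hl e') (hlF e')
    have hll : l e = l e' := le_antisymm
      (hlevel_le h₁' (heq ▸ h₁) (heq ▸ h₂)) (hlevel_le h₁ (heq ▸ h₁') (heq ▸ h₂'))
    refine Subtype.ext (hσinj (l e) ⟨hl e, hlF e⟩ ?_ ?_)
    · rw [hll]
      exact ⟨hl e', hlF e'⟩
    · rw [heq, hll]
  have hrange : ∀ e, e.1 ∈ F 0 → e ∉ Set.range τ := by
    rintro _ he ⟨e, rfl⟩
    obtain ⟨h₁, h₂, -⟩ := hσ _ _ (hl e) (hlF e)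
    have h0 : l e = 0 := Nat.le_zero.1 (hlevel_le (hFH 0 he) h₁ h₂)
    rw [h0] at h₂
    apply h₂
    have : (τ e).1 = σ 0 e.1 := by simp only [τ, h0]
    rwa [← this]
  have hfin : ∀ n, {e | (∃ m, e ∈ H m) ∧ ∃ x ∈ e, x ∉ C n}.Finite := by
    intro n
    refine (((Finset.range n).finite_toSet.biUnion fun m _ => (H m).finite_toSet).union
      (F n).finite_toSet).subset ?_
    rintro e ⟨⟨m, hm⟩, hx⟩
    rcases lt_or_ge m n with hmn | hmn
    · exact Or.inl (Set.mem_biUnion (by simpa using hmn) hm)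
    · obtain ⟨h₁, ⟨v, hv, hvC⟩, -⟩ := hHZ m e hm
      exact Or.inr (((hcut n).mem_iff e).2 ⟨h₁, ⟨v, hv, hC hmn hvC⟩, hx⟩)
  obtain ⟨A, hAF, hAr⟩ := Finset.exists_subset_card_eq (hr (C 0) (F 0) (hS0 ▸ hcut 0))
  let a : Fin r → {e // ∃ n, e ∈ H n} := fun i =>
    ⟨A.equivFin.symm (Fin.cast hAr.symm i), 0, hFH 0 (hAF (Subtype.property _))⟩
  have haF : ∀ i, a i ∉ Set.range τ := fun i =>
    hrange _ (hAF (A.equivFin.symm (Fin.cast hAr.symm i)).2)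
  have ha : Function.Injective a := by
    intro i j hij
    simpa [a, Subtype.ext_iff] using hij
  have hray := fun i => exists_ray_of_edge_sequence hlf (fun n => (τ^[n] (a i)).1)
    (fun m n h => (iterate_injective_of_notMem_range hτ (haF i) (haF i) (Subtype.ext h)).1)
    (fun n => by
      obtain ⟨m, hm⟩ := (τ^[n] (a i)).2
      exact (hHZ m _ hm).1)
    (fun n => by
      rw [Function.iterate_succ_apply']
      exact (hσ _ _ (hl _) (hlF _)).2.2)
  choose v j hv hvj using hray
  refine ⟨v, hv, fun i => ?_, fun i i' hii' => ?_⟩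
  · refine rayEquiv_of_edges_eventually_inside (hv i) hC (fun n => (hcut n).tail)
      (fun n => (hcut n).conn) hexh fun n => (hfin n).subset ?_
    rintro _ ⟨⟨m, rfl⟩, hx⟩
    refine ⟨?_, hx⟩
    simp only [hvj]
    exact (τ^[j i m] (a i)).2
  · refine Set.disjoint_left.2 ?_
    rintro _ ⟨m, rfl⟩ ⟨n, hn⟩
    simp only [hvj] at hn
    exact hii' (ha (iterate_injective_of_notMem_range hτ (haF i') (haF i)
      (Subtype.ext hn)).2.symm)

theorem HasEDisjointRays.mono {G : SimpleGraph V} {f : ℕ → V} {m n : ℕ} (hmn : m ≤ n)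
    (h : HasEDisjointRays G f n) : HasEDisjointRays G f m := by
  obtain ⟨F, h₁, h₂, h₃⟩ := h
  exact ⟨fun i => F (Fin.castLE hmn i), fun i => h₁ _, fun i => h₂ _,
    fun i j hij => h₃ fun h => hij (Fin.castLE_injective hmn h)⟩

/-- More edge-disjoint rays than cut edges: some starting vertex of a ray is not separated. -/
theorem HasEDisjointRays.exists_not_edgeCutSeparates {G : SimpleGraph V} {f : ℕ → V} {m : ℕ}
    (h : HasEDisjointRays G f (m + 1)) :
    ∃ S : Finset V, ∀ F : Finset (Sym2 V), F.card ≤ m → ¬ EdgeCutSeparates G F S f := by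
  classical
  obtain ⟨R, hR, hRf, hdisj⟩ := h
  refine ⟨Finset.univ.image fun i => R i 0, fun F hF ⟨N, hN⟩ => ?_⟩
  have hfree : ∃ i, ∀ n, s(R i n, R i (n + 1)) ∉ F := by
    by_contra! hcon
    choose n hn using hcon
    have hinj : Function.Injective fun i => s(R i (n i), R i (n i + 1)) := by
      intro i j hij
      by_contra hne
      exact Set.disjoint_left.1 (hdisj hne) ⟨n i, rfl⟩ ⟨n j, hij.symm⟩
    have := Finset.card_le_card_of_injOn (s := Finset.univ) (t := F) _ (fun i _ => hn i)
      hinj.injOn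
    simp only [Finset.card_univ, Fintype.card_fin] at this
    omega
  obtain ⟨i, hi⟩ := hfree
  obtain ⟨p, q, -, hq, w, hw⟩ := hRf i (F.biUnion Sym2.toFinset) 0 N
  have hinit : ∀ p, ∃ w : G.Walk (R i p) (R i 0), ∀ e ∈ w.edges, e ∉ F := by
    intro p
    induction p with
    | zero => exact ⟨Walk.nil, by simp⟩
    | succ p ih =>
      obtain ⟨w, hw⟩ := ih
      refine ⟨Walk.cons ((hR i).2 p).symm w, fun e he => ?_⟩
      rw [Walk.edges_cons, List.mem_cons] at he
      rcases he with rfl | he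
      · rw [Sym2.eq_swap]
        exact hi p
      · exact hw e he
  obtain ⟨w', hw'⟩ := hinit p
  refine hN q hq (R i 0) (Finset.mem_image_of_mem _ (Finset.mem_univ i))
    ⟨w.reverse.append w', fun e he heF => ?_⟩
  rw [Walk.edges_append, List.mem_append, Walk.edges_reverse, List.mem_reverse] at he
  rcases he with he | he
  · have hv := e.out_fst_mem
    exact hw _ (Walk.mem_support_of_mem_edges he hv)
      (Finset.mem_biUnion.2 ⟨e, heF, Sym2.mem_toFinset.2 hv⟩)
  · exact hw' e he heF

theorem EdgeCutSeparates.mono {G : SimpleGraph V} {f : ℕ → V} {F F' : Finset (Sym2 V)}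
    {S S' : Finset V} (h : EdgeCutSeparates G F S f) (hF : F ⊆ F') (hS : S' ⊆ S) :
    EdgeCutSeparates G F' S' f := by
  obtain ⟨N, hN⟩ := h
  exact ⟨N, fun n hn s hs ⟨w, hw⟩ => hN n hn s (hS hs) ⟨w, fun e he heF => hw e he (hF heF)⟩⟩

/-- Menger's theorem for ends: every finite vertex set is separated from the end by `m` edges iff
the end does not contain `m + 1` edge-disjoint rays. -/
theorem forall_exists_edgeCutSeparates_iff {G : SimpleGraph V}
    (hlf : ∀ x : V, (G.neighborSet x).Finite) {f : ℕ → V} (hf : IsRay G f) (m : ℕ) :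
    (∀ S : Finset V, ∃ F : Finset (Sym2 V), (F : Set (Sym2 V)) ⊆ G.edgeSet ∧ F.card = m ∧
      EdgeCutSeparates G F S f) ↔ ¬ HasEDisjointRays G f (m + 1) := by
  classical
  constructor
  · intro h hray
    obtain ⟨S, hS⟩ := hray.exists_not_edgeCutSeparates
    obtain ⟨F, -, hF, hsep⟩ := h S
    exact hS F hF.le hsep
  · intro hray S
    by_contra! hS
    refine hray (hasEDisjointRays_of_forall_le_card hlf hf (Finset.mem_insert_self (f 0) S) ?_)
    intro C F hCF
    by_contra! hlt
    have hFE : (F : Set (Sym2 V)) ⊆ G.edgeSet := fun e he => ((hCF.mem_iff e).1 he).1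
    have hinf : G.edgeSet.Infinite :=
      Set.infinite_of_injective_forall_mem hf.edge_injective fun n => hf.2 n
    obtain ⟨F', hFF', hF'E, hF'⟩ : ∃ F' : Finset (Sym2 V), F ⊆ F' ∧
        (F' : Set (Sym2 V)) ⊆ G.edgeSet ∧ F'.card = m := by
      obtain ⟨D, hDE, hD⟩ := (hinf.sdiff F.finite_toSet).exists_subset_card_eq (m - F.card)
      refine ⟨F ∪ D, Finset.subset_union_left, ?_, ?_⟩
      · rw [Finset.coe_union]
        exact Set.union_subset hFE fun e he => (hDE he).1
      · rw [Finset.card_union_of_disjoint, hD]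
        · omega
        · exact Finset.disjoint_left.2 fun e heF heD => (hDE heD).2 heF
    exact hS F' hF'E hF' (hCF.separates.mono hFF' (Finset.subset_insert _ _))

/-- In a locally finite graph, the edge-degree of an end `ω` equals `k` iff `k` is the
least integer such that every finite vertex set can be separated from `ω` by an edge-cut
of size `k`. -/
theorem stmt11 {V : Type u} (G : SimpleGraph V) (k : ℕ)
    (hlf : ∀ x : V, (G.neighborSet x).Finite) (f : ℕ → V) (hf : IsRay G f) :
    (HasEDisjointRays G f k ∧ ¬ HasEDisjointRays G f (k + 1)) ↔
      IsLeast {m : ℕ | ∀ S : Finset V, ∃ F : Finset (Sym2 V),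
        (F : Set (Sym2 V)) ⊆ G.edgeSet ∧ F.card = m ∧ EdgeCutSeparates G F S f} k := by
  have key : {m : ℕ | ∀ S : Finset V, ∃ F : Finset (Sym2 V),
      (F : Set (Sym2 V)) ⊆ G.edgeSet ∧ F.card = m ∧ EdgeCutSeparates G F S f} =
      {m | ¬ HasEDisjointRays G f (m + 1)} :=
    Set.ext fun m => forall_exists_edgeCutSeparates_iff hlf hf m
  rw [key]
  constructor
  · rintro ⟨hk, hk'⟩
    refine ⟨hk', fun m hm => ?_⟩
    by_contra! hlt
    exact hm (hk.mono hlt)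
  · rintro ⟨hk', hmin⟩
    refine ⟨?_, hk'⟩
    cases k with
    | zero => exact ⟨Fin.elim0, fun i => i.elim0, fun i => i.elim0, fun i => i.elim0⟩
    | succ k =>
      by_contra hk
      have := hmin hk
      omega
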